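/- Let α be a badly approximable real number whose continued fraction expansion begins with infinitely many palindromes, i.e. there are arbitrarily large n such that the word a₁a₂…aₙ of its first n partial quotients satisfies aᵢ = a_{n+1−i} for all 1 ≤ i ≤ n. Let β be any real number equal to α up to a rational homography, i.e. β = (aα + b)/(cα + d) with integers a, b, c, d and ad − bc ≠ 0. Then inf_{q ≥ 1} q · ‖qα‖ · ‖qβ‖ = 0, and moreover liminf_{q → ∞} q² · ‖qα‖ · ‖qβ‖ < +∞. -/

import Mathlib

open Filter Topology

/-- Distance from a real number to the nearest integer. -/
noncomputable def nint (x : ℝ) : ℝ := |x - round x|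

/-- A real number is badly approximable: `inf_{q ≥ 1} q·‖qα‖ > 0`. -/
def IsBad (α : ℝ) : Prop :=
  0 < ⨅ q : ℕ+, ((q : ℕ) : ℝ) * nint (((q : ℕ) : ℝ) * α)

/-- Denominators (continuants) of the continued fraction `[0; a 1, a 2, …]`:
`q 0 = 1`, `q 1 = a 1`, `q (j+2) = a (j+2) * q (j+1) + q j`. -/
def cfQ (a : ℕ → ℕ) : ℕ → ℕ
  | 0 => 1
  | 1 => a 1
  | n + 2 => a (n + 2) * cfQ a (n + 1) + cfQ a n

/-- Numerators of the continued fraction `[0; a 1, a 2, …]`. -/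
def cfP (a : ℕ → ℕ) : ℕ → ℕ
  | 0 => 0
  | 1 => 1
  | n + 2 => a (n + 2) * cfP a (n + 1) + cfP a n

/-- `a` (indexed from `1`) is the sequence of partial quotients of the continued
fraction expansion of `α`, i.e. `α = [0; a 1, a 2, …]`. -/
def IsCF (a : ℕ → ℕ) (α : ℝ) : Prop :=
  (∀ i, 1 ≤ i → 1 ≤ a i) ∧
    Tendsto (fun n => (cfP a n : ℝ) / (cfQ a n)) atTop (nhds α)

theorem nint_nonneg (x : ℝ) : 0 ≤ nint x := abs_nonneg _

theorem nint_le_abs_sub_int (x : ℝ) (m : ℤ) : nint x ≤ |x - m| := round_le x m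

theorem nint_natAbs_mul_le (z m : ℤ) (x : ℝ) :
    nint ((z.natAbs : ℝ) * x) ≤ |(z : ℝ) * x - m| := by
  rcases Int.natAbs_eq z with h | h
  · have hz : (z : ℝ) = (z.natAbs : ℝ) :=
      (congrArg (Int.cast : ℤ → ℝ) h).trans (Int.cast_natCast _)
    rw [hz]
    exact nint_le_abs_sub_int _ m
  · have hz : (z : ℝ) = -(z.natAbs : ℝ) := by exact_mod_cast h
    have := nint_le_abs_sub_int ((z.natAbs : ℝ) * x) (-m)
    rw [hz]
    refine this.trans_eq ?_
    rw [← abs_neg]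
    push_cast
    congr 1
    ring

/-- A badly approximable number is not a root of a nonzero integer linear form. -/
theorem IsBad.linear_form_ne_zero {α : ℝ} (hα : IsBad α) {C D : ℤ} (hCD : C ≠ 0 ∨ D ≠ 0) :
    (C : ℝ) * α + D ≠ 0 := by
  intro h
  have hC : C ≠ 0 := by
    rintro rfl
    simp_all
  have hpos : 0 < C.natAbs := Int.natAbs_pos.mpr hC
  have hle : (⨅ q : ℕ+, ((q : ℕ) : ℝ) * nint (((q : ℕ) : ℝ) * α)) ≤ 0 := by
    refine (ciInf_le ⟨0, ?_⟩ (⟨C.natAbs, hpos⟩ : ℕ+)).trans ?_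
    · rintro _ ⟨q, rfl⟩
      exact mul_nonneg (Nat.cast_nonneg _) (nint_nonneg _)
    · have h1 := nint_natAbs_mul_le C (-D) α
      have h2 : (C : ℝ) * α - ((-D : ℤ) : ℝ) = 0 := by push_cast; linarith
      rw [h2, abs_zero] at h1
      exact mul_nonpos_of_nonneg_of_nonpos (Nat.cast_nonneg _) h1
  exact absurd hα (not_lt.mpr hle)

section Continuants

variable {a : ℕ → ℕ}

theorem cfQ_pos (ha : ∀ i, 1 ≤ i → 1 ≤ a i) (n : ℕ) : 0 < cfQ a n := by
  induction n using Nat.twoStepInduction with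
  | zero => simp [cfQ]
  | one => exact ha 1 le_rfl
  | more n h0 _ => exact Nat.add_pos_right _ h0

theorem cfQ_le_succ (ha : ∀ i, 1 ≤ i → 1 ≤ a i) (n : ℕ) : cfQ a n ≤ cfQ a (n + 1) := by
  cases n with
  | zero => exact ha 1 le_rfl
  | succ n =>
    have := ha (n + 2) (by omega)
    simp only [cfQ]
    nlinarith [Nat.zero_le (cfQ a (n + 1))]

theorem le_cfQ (ha : ∀ i, 1 ≤ i → 1 ≤ a i) (n : ℕ) : n ≤ cfQ a n := by
  induction n using Nat.twoStepInduction with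
  | zero => simp
  | one => exact ha 1 le_rfl
  | more n _ h1 =>
    have := ha (n + 2) (by omega)
    have := cfQ_pos ha n
    simp only [cfQ]
    nlinarith

theorem cf_det (a : ℕ → ℕ) (n : ℕ) :
    (-1 : ℝ) ^ n * (cfQ a n * cfP a (n + 1) - cfP a n * cfQ a (n + 1)) = 1 := by
  induction n with
  | zero => simp [cfQ, cfP]
  | succ n ih =>
    simp only [cfQ, cfP, pow_succ] at ih ⊢
    push_cast
    linear_combination ih

theorem cf_cross_bounds (a : ℕ → ℕ) (n k : ℕ) :
    0 ≤ (-1 : ℝ) ^ n * (cfQ a n * cfP a (n + k) - cfP a n * cfQ a (n + k)) ∧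
      cfQ a (n + 1) * ((-1 : ℝ) ^ n * (cfQ a n * cfP a (n + k) - cfP a n * cfQ a (n + k)))
        ≤ cfQ a (n + k) := by
  induction k using Nat.twoStepInduction with
  | zero => constructor <;> simp [mul_comm]
  | one => rw [cf_det]; simp
  | more k h0 h1 =>
    have hQ : (cfQ a (n + (k + 2)) : ℝ) = a (n + k + 2) * cfQ a (n + (k + 1)) + cfQ a (n + k) := by
      exact_mod_cast (rfl : cfQ a (n + k + 2) = _)
    have hP : (cfP a (n + (k + 2)) : ℝ) = a (n + k + 2) * cfP a (n + (k + 1)) + cfP a (n + k) := by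
      exact_mod_cast (rfl : cfP a (n + k + 2) = _)
    have hpos : (0 : ℝ) ≤ a (n + k + 2) := Nat.cast_nonneg _
    rw [hQ, hP]
    constructor
    · linarith [mul_nonneg hpos h1.1, h0.1]
    · linarith [mul_le_mul_of_nonneg_left h1.2 hpos, h0.2]

/-- Each convergent satisfies `|q n α - p n| ≤ 1 / q (n + 1)`. -/
theorem IsCF.abs_sub_le {α : ℝ} (h : IsCF a α) (n : ℕ) :
    |(cfQ a n : ℝ) * α - cfP a n| ≤ 1 / cfQ a (n + 1) := by
  have hlim : Tendsto (fun k => |(cfQ a n : ℝ) * ((cfP a (k + n) : ℝ) / cfQ a (k + n)) - cfP a n|)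
      atTop (𝓝 |(cfQ a n : ℝ) * α - cfP a n|) :=
    ((((tendsto_add_atTop_iff_nat n).mpr h.2).const_mul _).sub_const _).abs
  refine le_of_tendsto' hlim fun k => ?_
  have hk : (0 : ℝ) < cfQ a (k + n) := by exact_mod_cast cfQ_pos h.1 _
  have hn : (0 : ℝ) < cfQ a (n + 1) := by exact_mod_cast cfQ_pos h.1 _
  have hb := cf_cross_bounds a n k
  rw [add_comm n k] at hb
  have heq : (cfQ a n : ℝ) * ((cfP a (k + n) : ℝ) / cfQ a (k + n)) - cfP a n =
      (cfQ a n * cfP a (k + n) - cfP a n * cfQ a (k + n)) / cfQ a (k + n) := by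
    field_simp
  have habs := abs_of_nonneg hb.1
  rw [abs_mul, abs_neg_one_pow, one_mul] at habs
  rw [heq, abs_div, abs_of_pos hk, habs, div_le_div_iff₀ hk hn]
  linarith [hb.2]

theorem cf_matrix_prod (a : ℕ → ℕ) (n : ℕ) :
    ((List.range (n + 1)).map fun i => (!![a (i + 1), 1; 1, 0] : Matrix (Fin 2) (Fin 2) ℕ)).prod =
      !![cfQ a (n + 1), cfQ a n; cfP a (n + 1), cfP a n] := by
  induction n with
  | zero => simp [cfQ, cfP]
  | succ n ih =>
    rw [List.range_succ, List.map_append, List.prod_append, ih]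
    simp [cfQ, cfP, mul_comm]

theorem cfP_eq_cfQ_of_palindrome {n : ℕ}
    (h : ∀ i, 1 ≤ i → i ≤ n + 1 → a i = a (n + 1 + 1 - i)) : cfP a (n + 1) = cfQ a n := by
  have ht := Matrix.transpose_list_prod
    ((List.range (n + 1)).map fun i => (!![a (i + 1), 1; 1, 0] : Matrix (Fin 2) (Fin 2) ℕ))
  have hl : ((((List.range (n + 1)).map fun i =>
      (!![a (i + 1), 1; 1, 0] : Matrix (Fin 2) (Fin 2) ℕ)).map Matrix.transpose).reverse) =
      (List.range (n + 1)).map fun i => !![a (i + 1), 1; 1, 0] := by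
    refine List.ext_getElem (by simp) fun i hi _ => ?_
    have hi' : i < n + 1 := by simpa using hi
    have := h (i + 1) (by omega) (by omega)
    have hidx : n - i + 1 = n + 1 - i := by omega
    ext j k
    fin_cases j <;> fin_cases k <;> simp [this, hidx]
  rw [hl, cf_matrix_prod] at ht
  simpa using congrFun (congrFun ht 0) 1

end Continuants

theorem iInf_eq_zero_of_frequently_sq_mul_le {f : ℕ → ℝ} (hf : ∀ q, 0 ≤ f q) {c : ℝ}
    (h : ∃ᶠ q : ℕ in atTop, (q : ℝ) ^ 2 * f q ≤ c) :
    (⨅ q : ℕ+, ((q : ℕ) : ℝ) * f q) = 0 := by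
  have hnonneg : ∀ q : ℕ+, 0 ≤ ((q : ℕ) : ℝ) * f q := fun q =>
    mul_nonneg (Nat.cast_nonneg _) (hf _)
  refine le_antisymm (le_of_forall_pos_le_add fun ε hε => ?_) (Real.iInf_nonneg hnonneg)
  obtain ⟨N, hN⟩ := exists_nat_gt (c / ε)
  obtain ⟨q, hq, hc⟩ := (frequently_atTop.mp h) (N + 1)
  have hq0 : 0 < q := by omega
  refine (ciInf_le ⟨0, by rintro _ ⟨q, rfl⟩; exact hnonneg q⟩ (⟨q, hq0⟩ : ℕ+)).trans ?_
  have hqN : (N : ℝ) ≤ q := by exact_mod_cast (by omega : N ≤ q)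
  have hqR : (0 : ℝ) < q := by exact_mod_cast hq0
  rw [div_lt_iff₀ hε] at hN
  have hcq : c ≤ q * ε := hN.le.trans (mul_le_mul_of_nonneg_right hqN hε.le)
  rw [zero_add]
  refine le_of_mul_le_mul_left ?_ hqR
  simpa [sq, mul_assoc] using hc.trans hcq

/-- Theorem 6 of Adamczewski–Bugeaud.  Let `α` be badly
approximable whose continued fraction expansion begins with infinitely many
palindromes, and let `β` be equal to `α` up to a rational homography.  Then
`inf_{q ≥ 1} q·‖qα‖·‖qβ‖ = 0` and, moreover,
`liminf_{q → ∞} q²·‖qα‖·‖qβ‖ < +∞`, i.e. `q²·‖qα‖·‖qβ‖ ≤ c` for some constant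
`c` and infinitely many `q`. -/
theorem littlewood_of_palindromic_prefixes
    (α : ℝ) (a : ℕ → ℕ) (hcf : IsCF a α) (hbad : IsBad α)
    (hpal : ∀ N : ℕ, ∃ n : ℕ, N ≤ n ∧ 1 ≤ n ∧
      ∀ i, 1 ≤ i → i ≤ n → a i = a (n + 1 - i))
    (β : ℝ) (A B C D : ℤ) (hdet : A * D - B * C ≠ 0)
    (hβ : β = ((A : ℝ) * α + B) / ((C : ℝ) * α + D)) :
    (⨅ q : ℕ+, ((q : ℕ) : ℝ) * nint (((q : ℕ) : ℝ) * α) *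
        nint (((q : ℕ) : ℝ) * β)) = 0 ∧
    ∃ c : ℝ, ∃ᶠ q : ℕ in atTop,
      (q : ℝ) ^ 2 * nint ((q : ℝ) * α) * nint ((q : ℝ) * β) ≤ c := by
  have hCD : C ≠ 0 ∨ D ≠ 0 := by
    by_contra! h
    exact hdet (by simp [h.1, h.2])
  have hden : (C : ℝ) * α + D ≠ 0 := hbad.linear_form_ne_zero hCD
  have hkey : ∃ c : ℝ, ∃ᶠ q : ℕ in atTop,
      (q : ℝ) ^ 2 * nint ((q : ℝ) * α) * nint ((q : ℝ) * β) ≤ c := by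
    set K : ℝ := |(C : ℝ)| + |(D : ℝ)| with hK
    have hK0 : 0 ≤ K := by positivity
    refine ⟨K ^ 2 * K * |A - C * β|, frequently_atTop.mpr fun N => ?_⟩
    obtain ⟨M, hM⟩ := exists_nat_ge ((N + |(C : ℝ)|) / |(C : ℝ) * α + D|)
    obtain ⟨n, hMn, hn1, hn⟩ := hpal M
    obtain ⟨m, rfl⟩ : ∃ m, n = m + 1 := ⟨n - 1, by omega⟩
    have hPQ := cfP_eq_cfQ_of_palindrome hn
    have hQ1 : (1 : ℝ) ≤ cfQ a (m + 1) := by exact_mod_cast cfQ_pos hcf.1 (m + 1)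
    have hMQ : (M : ℝ) ≤ cfQ a (m + 1) := by exact_mod_cast hMn.trans (le_cfQ hcf.1 (m + 1))
    have hpQ : (cfP a (m + 1) : ℝ) ≤ cfQ a (m + 1) := by
      exact_mod_cast hPQ.trans_le (cfQ_le_succ hcf.1 m)
    have hQQ : (cfQ a (m + 1) : ℝ) ≤ cfQ a (m + 1 + 1) := by
      exact_mod_cast cfQ_le_succ hcf.1 (m + 1)
    have hp0 : (0 : ℝ) ≤ cfP a (m + 1) := Nat.cast_nonneg _
    have hprev := hcf.abs_sub_le m
    rw [← hPQ] at hprev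
    have hcur := (hcf.abs_sub_le (m + 1)).trans
      (one_div_le_one_div_of_le (by linarith) hQQ)
    set z : ℤ := C * cfP a (m + 1) + D * cfQ a (m + 1) with hz
    have hzα := nint_natAbs_mul_le z (C * cfP a m + D * cfP a (m + 1)) α
    have hzβ := nint_natAbs_mul_le z (A * cfP a (m + 1) + B * cfQ a (m + 1)) β
    have hzabs : ((z.natAbs : ℕ) : ℝ) = |(z : ℝ)| := Nat.cast_natAbs z |>.trans (by simp)
    have hzR : (z : ℝ) = C * cfP a (m + 1) + D * cfQ a (m + 1) := by rw [hz]; push_cast; rfl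
    push_cast at hzα hzβ
    generalize (cfQ a (m + 1) : ℝ) = Q at *
    generalize (cfP a (m + 1) : ℝ) = P at *
    have hQ0 : 0 < Q := by linarith
    have hβ' : β * (C * α + D) = A * α + B := by rw [hβ, div_mul_cancel₀ _ hden]
    have hαle : nint ((z.natAbs : ℝ) * α) ≤ K / Q := by
      refine hzα.trans ?_
      have : (z : ℝ) * α - (C * cfP a m + D * P) = C * (P * α - cfP a m) + D * (Q * α - P) := by
        rw [hzR]; ring
      rw [this]
      refine (abs_add_le _ _).trans ?_
      rw [abs_mul, abs_mul, hK, add_div, div_eq_mul_one_div, div_eq_mul_one_div |(D : ℝ)|]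
      gcongr
    have hβle : nint ((z.natAbs : ℝ) * β) ≤ |A - C * β| / Q := by
      refine hzβ.trans ?_
      have : (z : ℝ) * β - (A * P + B * Q) = (A - C * β) * (Q * α - P) := by
        rw [hzR]; linear_combination Q * hβ'
      rw [this, abs_mul, div_eq_mul_one_div]
      gcongr
    have hzle : (z.natAbs : ℝ) ≤ K * Q := by
      rw [hzabs, hzR, hK, add_mul]
      refine (abs_add_le _ _).trans ?_
      rw [abs_mul, abs_mul, abs_of_nonneg hp0, abs_of_pos hQ0]
      gcongr
    refine ⟨z.natAbs, ?_, ?_⟩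
    · have hlow : |(C : ℝ) * α + D| * Q - |(C : ℝ)| ≤ |(z : ℝ)| := by
        have h1 : (C * α + D) * Q = z + C * (Q * α - P) := by rw [hzR]; ring
        have h2 := abs_add_le (z : ℝ) (C * (Q * α - P))
        rw [← h1, abs_mul, abs_mul, abs_of_pos hQ0] at h2
        have h3 : |Q * α - P| ≤ 1 := hcur.trans (by rw [div_le_one hQ0]; exact hQ1)
        have h4 := mul_le_mul_of_nonneg_left h3 (abs_nonneg (C : ℝ))
        linarith
      have hd : 0 < |(C : ℝ) * α + D| := abs_pos.mpr hden
      have h5 := hM.trans hMQ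
      rw [div_le_iff₀ hd] at h5
      have : (N : ℝ) ≤ (z.natAbs : ℝ) := by rw [hzabs]; linarith
      exact_mod_cast this
    · calc (z.natAbs : ℝ) ^ 2 * nint ((z.natAbs : ℝ) * α) * nint ((z.natAbs : ℝ) * β)
          ≤ (K * Q) ^ 2 * (K / Q) * (|A - C * β| / Q) := by
            gcongr <;> exact nint_nonneg _
        _ = K ^ 2 * K * |A - C * β| := by field_simp
  refine ⟨?_, hkey⟩
  obtain ⟨c, hc⟩ := hkey
  simp only [mul_assoc] at hc ⊢
  exact iInf_eq_zero_of_frequently_sq_mul_le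
    (f := fun q : ℕ => nint ((q : ℝ) * α) * nint ((q : ℝ) * β))
    (fun q => mul_nonneg (nint_nonneg _) (nint_nonneg _)) hc
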